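/- Let R be a commutative ring and M an R-module. The following are equivalent: (1) Tor_1^R(M, N) is Q-torsion for every R-module N (M is τ_q-flat); (2) the localization M_m is a flat R_m-module for every maximal q-ideal m of R; (3) M ⊗_R T(R[x]) is a flat T(R[x])-module. -/

import Mathlib

open Polynomial TensorProduct

universe u v

/-- An ideal is *semi-regular* if it contains a finitely generated dense subideal
(an ideal is *dense* if its annihilator is zero). -/
def Ideal.IsSemiregular {R : Type*} [CommRing R] (I : Ideal R) : Prop :=
  ∃ J : Ideal R, J ≤ I ∧ J.FG ∧ Submodule.annihilator J = ⊥

/-- A module is *Q-torsion* if every element is annihilated by some finitely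
generated semi-regular ideal. -/
def IsQTorsion (R : Type*) (M : Type*) [CommRing R] [AddCommGroup M] [Module R M] : Prop :=
  ∀ m : M, ∃ I : Ideal R, I.FG ∧ I.IsSemiregular ∧ ∀ a ∈ I, a • m = 0

open CategoryTheory in
/-- `Tor_1^R(M, N)` as an `R`-module. -/
noncomputable def Tor1Mod (R : Type u) [CommRing R] (M N : Type u)
    [AddCommGroup M] [Module R M] [AddCommGroup N] [Module R N] : ModuleCat R :=
  ((Tor (ModuleCat.{u} R) 1).obj (ModuleCat.of R M)).obj (ModuleCat.of R N)

/-- A module is *τ_q-flat* if `Tor_1^R(M, N)` is Q-torsion for every module `N`. -/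
def IsTauQFlat (R : Type u) [CommRing R] (M : Type u) [AddCommGroup M] [Module R M] : Prop :=
  ∀ (N : Type u) [AddCommGroup N] [Module R N], IsQTorsion R (Tor1Mod R M N)

open CategoryTheory in
theorem isQTorsion_homology_iff {R : Type u} [CommRing R] (S : ShortComplex (ModuleCat.{u} R)) :
    IsQTorsion R S.homology ↔ ∀ x : S.X₂, S.g.hom x = 0 →
      ∃ I : Ideal R, I.FG ∧ I.IsSemiregular ∧ ∀ a ∈ I, a • x ∈ LinearMap.range S.f.hom := by
  let e : S.homology ≃ₗ[R] (LinearMap.ker S.g.hom ⧸ LinearMap.range S.moduleCatToCycles) :=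
    S.moduleCatHomologyIso.toLinearEquiv
  have key : ∀ (x : LinearMap.ker S.g.hom) (a : R),
      a • e.symm (Submodule.Quotient.mk x) = 0 ↔ a • x.1 ∈ LinearMap.range S.f.hom := by
    intro x a
    rw [← map_smul, e.symm.map_eq_zero_iff]
    rw [← Submodule.Quotient.mk_smul, Submodule.Quotient.mk_eq_zero]
    constructor
    · rintro ⟨y, hy⟩
      exact ⟨y, congrArg Subtype.val hy⟩
    · rintro ⟨y, hy⟩
      exact ⟨y, Subtype.ext hy⟩
  constructor
  · intro h x hx
    obtain ⟨I, h1, h2, h3⟩ := h (e.symm (Submodule.Quotient.mk ⟨x, hx⟩))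
    exact ⟨I, h1, h2, fun a ha => (key ⟨x, hx⟩ a).1 (h3 a ha)⟩
  · intro h t
    obtain ⟨t, rfl⟩ := e.symm.surjective t
    obtain ⟨x, rfl⟩ := Submodule.Quotient.mk_surjective _ t
    obtain ⟨I, h1, h2, h3⟩ := h x.1 x.2
    exact ⟨I, h1, h2, fun a ha => (key x a).2 (h3 a ha)⟩

theorem IsQTorsion.of_linearEquiv {R M N : Type*} [CommRing R] [AddCommGroup M] [Module R M]
    [AddCommGroup N] [Module R N] (e : M ≃ₗ[R] N) (h : IsQTorsion R M) : IsQTorsion R N := by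
  intro n
  obtain ⟨I, h1, h2, h3⟩ := h (e.symm n)
  exact ⟨I, h1, h2, fun a ha => by simpa using congrArg e (h3 a ha)⟩

open CategoryTheory MonoidalCategory in
theorem exists_resolution_isQTorsion_tor1Mod_iff (R : Type u) [CommRing R] (M N : Type u)
    [AddCommGroup M] [Module R M] [AddCommGroup N] [Module R N] :
    ∃ (P₂ P₁ P₀ : ModuleCat.{u} R) (d₂ : P₂ →ₗ[R] P₁) (d₁ : P₁ →ₗ[R] P₀) (ε : P₀ →ₗ[R] N),
      Module.Projective R P₀ ∧ Function.Exact d₂ d₁ ∧ Function.Exact d₁ ε ∧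
      Function.Surjective ε ∧
      (IsQTorsion R (Tor1Mod R M N) ↔ ∀ w : M ⊗[R] P₁, d₁.lTensor M w = 0 →
        ∃ I : Ideal R, I.FG ∧ I.IsSemiregular ∧
          ∀ a ∈ I, a • w ∈ LinearMap.range (d₂.lTensor M)) := by
  let P := projectiveResolution (ModuleCat.of R N)
  let F := (tensoringLeft (ModuleCat.{u} R)).obj (ModuleCat.of R M)
  let K := (F.mapHomologicalComplex _).obj P.complex
  let e : Tor1Mod R M N ≅ (K.sc' 2 1 0).homology :=
    P.isoLeftDerivedObj F 1 ≪≫ ShortComplex.homologyMapIso (K.isoSc' 2 1 0 (by simp) (by simp))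
  refine ⟨P.complex.X 2, P.complex.X 1, P.complex.X 0, (P.complex.d 2 1).hom,
    (P.complex.d 1 0).hom, (P.π.f 0).hom, ?_, ?_, ?_, ?_, ?_⟩
  · exact (IsProjective.iff_projective _).2 (P.projective 0)
  · exact (ShortComplex.ShortExact.moduleCat_exact_iff_function_exact _).1 (P.exact_succ 0)
  · exact (ShortComplex.ShortExact.moduleCat_exact_iff_function_exact _).1
      (ShortComplex.exact_of_g_is_cokernel (ShortComplex.mk _ _ P.complex_d_comp_π_f_zero)
        P.isColimitCokernelCofork)
  · exact (ModuleCat.epi_iff_surjective (P.π.f 0)).1 inferInstance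
  · rw [show IsQTorsion R (Tor1Mod R M N) ↔ IsQTorsion R (K.sc' 2 1 0).homology from
      ⟨.of_linearEquiv e.toLinearEquiv, .of_linearEquiv e.toLinearEquiv.symm⟩,
      isQTorsion_homology_iff]
    rfl

namespace Ideal

theorem annihilator_eq_bot_of_le {R : Type*} [CommRing R] {I J : Ideal R} (h : J ≤ I)
    (hJ : Submodule.annihilator J = ⊥) : Submodule.annihilator I = ⊥ :=
  le_bot_iff.1 (hJ ▸ Submodule.annihilator_mono h)

theorem IsSemiregular.mono {R : Type*} [CommRing R] {I J : Ideal R} (h : J ≤ I)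
    (hJ : J.IsSemiregular) : I.IsSemiregular :=
  let ⟨K, hK, h'⟩ := hJ
  ⟨K, hK.trans h, h'⟩

theorem IsSemiregular.annihilator_eq_bot {R : Type*} [CommRing R] {I : Ideal R}
    (hI : I.IsSemiregular) : Submodule.annihilator I = ⊥ :=
  let ⟨_, hJ, _, h⟩ := hI
  annihilator_eq_bot_of_le hJ h

theorem isSemiregular_top (R : Type*) [CommRing R] : (⊤ : Ideal R).IsSemiregular :=
  ⟨⊤, le_rfl, Module.Finite.fg_top, (eq_bot_iff.2 fun r hr => by
    simpa using Submodule.mem_annihilator.1 hr 1 trivial)⟩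

theorem IsSemiregular.mul {R : Type*} [CommRing R] {I J : Ideal R}
    (hI : I.IsSemiregular) (hJ : J.IsSemiregular) : (I * J).IsSemiregular := by
  obtain ⟨I', hI', hIfg, hI⟩ := hI
  obtain ⟨J', hJ', hJfg, hJ⟩ := hJ
  refine ⟨I' * J', Ideal.mul_mono hI' hJ', hIfg.mul hJfg, eq_bot_iff.2 fun r hr => ?_⟩
  rw [← hI, Submodule.mem_annihilator]
  intro a ha
  rw [← Submodule.mem_bot R, ← hJ, Submodule.mem_annihilator]
  intro b hb
  simpa [mul_assoc] using Submodule.mem_annihilator.1 hr (a * b) (Ideal.mul_mem_mul ha hb)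

theorem exists_le_maximal_not_isSemiregular {R : Type*} [CommRing R] {I : Ideal R}
    (hI : ¬ I.IsSemiregular) : ∃ m : Ideal R, I ≤ m ∧ ¬ m.IsSemiregular ∧
      ∀ J : Ideal R, ¬ J.IsSemiregular → m ≤ J → J = m := by
  obtain ⟨m, hm, hmax⟩ := zorn_le_nonempty₀ {J : Ideal R | ¬ J.IsSemiregular} (by
    intro c hc hchain y hy
    refine ⟨sSup c, ?_, fun z hz => le_sSup hz⟩
    rintro ⟨K, hK, hfg, hann⟩
    obtain ⟨J, hJ, hKJ⟩ :=
      (CompleteLattice.isCompactElement_iff_le_of_directed_sSup_le _ K).1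
        ((Submodule.fg_iff_compact K).1 hfg) c ⟨y, hy⟩ hchain.directedOn hK
    exact hc hJ ⟨K, hKJ, hfg, hann⟩) I hI
  exact ⟨m, hm, hmax.prop, fun J hJ h => le_antisymm (hmax.le_of_ge hJ h) h⟩

theorem isPrime_of_maximal_not_isSemiregular {R : Type*} [CommRing R] {m : Ideal R}
    (hm : ¬ m.IsSemiregular) (hmax : ∀ J : Ideal R, ¬ J.IsSemiregular → m ≤ J → J = m) :
    m.IsPrime := by
  refine ⟨fun h => hm (h ▸ isSemiregular_top R), fun {a b} hab => ?_⟩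
  by_contra! h
  have key : ∀ c ∉ m, (m ⊔ span {c}).IsSemiregular := fun c hc => by
    by_contra hn
    exact hc (hmax _ hn le_sup_left ▸ mem_sup_right (mem_span_singleton_self c))
  refine hm (((key a h.1).mul (key b h.2)).mono ?_)
  rw [sup_mul, mul_sup, mul_sup, span_singleton_mul_span_singleton]
  exact sup_le (sup_le mul_le_left mul_le_left)
    (sup_le mul_le_right ((span_singleton_le_iff_mem _).2 hab))

theorem IsSemiregular.map_atPrime_eq_top {R : Type*} [CommRing R] {m : Ideal R} [m.IsPrime]
    (hm : ¬ m.IsSemiregular) {J : Ideal R} (hJ : J.IsSemiregular) :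
    J.map (algebraMap R (Localization.AtPrime m)) = ⊤ := by
  obtain ⟨a, haJ, ham⟩ := Set.not_subset.1 fun h => hm (hJ.mono h)
  exact eq_top_of_isUnit_mem _ (mem_map_of_mem _ haJ)
    (IsLocalization.map_units _ (⟨a, ham⟩ : m.primeCompl))

theorem map_fractionRing_polynomial_eq_top {R : Type*} [CommRing R] {J : Ideal R}
    (hfg : J.FG) (hJ : J.IsSemiregular) :
    J.map (algebraMap R (FractionRing R[X])) = ⊤ := by
  obtain ⟨n, g, rfl⟩ := Submodule.fg_iff_exists_fin_generating_family.1 hfg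
  set J : Ideal R := Submodule.span R (Set.range g)
  let f : R[X] := ∑ i : Fin n, C (g i) * X ^ (i : ℕ)
  have hcoeff : ∀ i : Fin n, f.coeff i = g i := fun i => by
    simp [f, Polynomial.coeff_X_pow, Fin.val_inj]
  have hf : f ∈ nonZeroDivisors R[X] := by
    refine Polynomial.mem_nonZeroDivisors_iff.2 fun r hr => ?_
    rw [← Submodule.mem_bot R, ← hJ.annihilator_eq_bot, Submodule.mem_annihilator_span]
    rintro ⟨_, i, rfl⟩
    simpa [hcoeff] using congrArg (fun p => p.coeff (i : ℕ)) hr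
  have hfJ : f ∈ Ideal.map (algebraMap R R[X]) J := sum_mem _ fun i _ =>
    mul_mem_right _ _ (mem_map_of_mem _ (Submodule.subset_span (Set.mem_range_self i)))
  rw [IsScalarTower.algebraMap_eq R R[X] (FractionRing R[X]), ← map_map]
  exact eq_top_of_isUnit_mem _ (mem_map_of_mem _ hfJ)
    (IsLocalization.map_units _ (⟨f, hf⟩ : nonZeroDivisors R[X]))

end Ideal

theorem Polynomial.isSemiregular_span_coeffs {R : Type*} [CommRing R] {f : R[X]}
    (hf : f ∈ nonZeroDivisors R[X]) : (Ideal.span (f.coeffs : Set R)).IsSemiregular := by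
  refine ⟨_, le_rfl, ⟨f.coeffs, rfl⟩, eq_bot_iff.2 fun r hr => ?_⟩
  refine Polynomial.mem_nonZeroDivisors_iff.1 hf r (Polynomial.ext fun n => ?_)
  by_cases hn : f.coeff n = 0
  · simp [hn]
  · simpa using Submodule.mem_annihilator.1 hr _
      (Ideal.subset_span (Polynomial.coeff_mem_coeffs hn))

theorem Polynomial.exists_smul_eq_zero_of_one_tmul_eq_zero {R H : Type*} [CommRing R]
    [AddCommGroup H] [Module R H] {h : H} (hh : (1 : FractionRing R[X]) ⊗ₜ[R] h = 0) :
    ∃ I : Ideal R, I.FG ∧ I.IsSemiregular ∧ ∀ a ∈ I, a • h = 0 := by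
  have h1 : TensorProduct.mk R[X] (FractionRing R[X]) (R[X] ⊗[R] H) 1 (1 ⊗ₜ h) = 0 := by
    apply (TensorProduct.AlgebraTensorModule.cancelBaseChange R R[X] R[X]
      (FractionRing R[X]) H).injective
    simpa using hh
  obtain ⟨⟨f, hf⟩, hfh⟩ := (IsLocalizedModule.eq_zero_iff (nonZeroDivisors R[X]) _).1 h1
  refine ⟨_, ⟨f.coeffs, rfl⟩, isSemiregular_span_coeffs hf, fun a ha => ?_⟩
  suffices hle : Ideal.span (f.coeffs : Set R) ≤ Ideal.torsionOf R H h from hle ha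
  refine Ideal.span_le.2 fun c hc => ?_
  obtain ⟨n, -, rfl⟩ := Polynomial.mem_coeffs_iff.1 hc
  have h2 : f ⊗ₜ[R] h = 0 := by simpa [Submonoid.smul_def, TensorProduct.smul_tmul'] using hfh
  simpa using congrArg (fun t => TensorProduct.lid R H ((Polynomial.lcoeff R n).rTensor H t)) h2

theorem Ideal.exists_smul_eq_zero_of_forall_atPrime {R H : Type*} [CommRing R]
    [AddCommGroup H] [Module R H] {h : H}
    (hh : ∀ (m : Ideal R) [m.IsPrime], ¬ m.IsSemiregular →
      (∀ I : Ideal R, ¬ I.IsSemiregular → m ≤ I → I = m) →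
      (1 : Localization.AtPrime m) ⊗ₜ[R] h = 0) :
    ∃ I : Ideal R, I.FG ∧ I.IsSemiregular ∧ ∀ a ∈ I, a • h = 0 := by
  by_cases hs : (Ideal.torsionOf R H h).IsSemiregular
  · obtain ⟨J, hJ, hfg, hann⟩ := hs
    exact ⟨J, hfg, ⟨J, le_rfl, hfg, hann⟩, fun a ha => hJ ha⟩
  · obtain ⟨m, hle, hm, hmax⟩ := exists_le_maximal_not_isSemiregular hs
    have := isPrime_of_maximal_not_isSemiregular hm hmax
    obtain ⟨⟨c, hc⟩, hch⟩ := (IsLocalizedModule.eq_zero_iff m.primeCompl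
      (TensorProduct.mk R (Localization.AtPrime m) H 1)).1 (hh m hm hmax)
    exact absurd (hle hch) hc

theorem IsTauQFlat.exists_smul_eq_zero {R : Type u} [CommRing R] {M : Type u} [AddCommGroup M]
    [Module R M] (h : IsTauQFlat R M) {N' N : Type u} [AddCommGroup N'] [Module R N']
    [AddCommGroup N] [Module R N] {i : N' →ₗ[R] N} (hi : Function.Injective i)
    {z : M ⊗[R] N'} (hz : i.lTensor M z = 0) :
    ∃ I : Ideal R, I.FG ∧ I.IsSemiregular ∧ ∀ a ∈ I, a • z = 0 := by
  obtain ⟨P₂, P₁, P₀, d₂, d₁, ε, _, h₂₁, h₁₀, hε, htor⟩ :=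
    exists_resolution_isQTorsion_tor1Mod_iff R M (N ⧸ LinearMap.range i)
  obtain ⟨φ, hφ⟩ := Module.projective_lifting_property (LinearMap.range i).mkQ ε
    (Submodule.mkQ_surjective _)
  have hφ' : ∀ p, Submodule.Quotient.mk (φ p) = ε p := fun p => LinearMap.congr_fun hφ p
  let ψ : P₁ →ₗ[R] N' := (LinearEquiv.ofInjective i hi).symm.toLinearMap ∘ₗ
    (φ ∘ₗ d₁).codRestrict (LinearMap.range i) fun p => by
      rw [← Submodule.Quotient.mk_eq_zero, LinearMap.comp_apply, hφ', h₁₀.apply_apply_eq_zero]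
  have hψ : ∀ p, i (ψ p) = φ (d₁ p) := fun p => by
    simp [ψ]
  have hψd : ψ ∘ₗ d₂ = 0 := LinearMap.ext fun p => hi (by
    simp [hψ, h₂₁.apply_apply_eq_zero])
  have hex : Function.Exact (d₁.prod (-ψ)) (φ.coprod i) := by
    rintro ⟨p, n⟩
    constructor
    · intro hpn
      replace hpn : φ p + i n = 0 := by simpa using hpn
      obtain ⟨q, rfl⟩ := (h₁₀ p).1 (by
        rw [← hφ', Submodule.Quotient.mk_eq_zero, eq_neg_of_add_eq_zero_left hpn]
        exact neg_mem ⟨n, rfl⟩)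
      refine ⟨q, Prod.ext rfl (hi ?_)⟩
      simp [hψ, eq_neg_of_add_eq_zero_right hpn]
    · rintro ⟨q, hq⟩
      rw [← hq]
      simp [hψ]
  have hsurj : Function.Surjective (φ.coprod i) := fun n => by
    obtain ⟨p, hp⟩ := hε (Submodule.Quotient.mk n)
    obtain ⟨n', hn'⟩ := (Submodule.Quotient.eq _).1 (hp.symm.trans (hφ' p).symm)
    exact ⟨(p, n'), by simp [hn']⟩
  obtain ⟨w, hw⟩ := (lTensor_exact M hex hsurj ((LinearMap.inr R P₀ N').lTensor M z)).1 (by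
    rw [← LinearMap.comp_apply, ← LinearMap.lTensor_comp, LinearMap.coprod_inr, hz])
  have hw₁ : d₁.lTensor M w = 0 := by
    have := congrArg ((LinearMap.fst R P₀ N').lTensor M) hw
    rwa [← LinearMap.comp_apply, ← LinearMap.comp_apply, ← LinearMap.lTensor_comp,
      ← LinearMap.lTensor_comp, LinearMap.fst_prod, LinearMap.fst_comp_inr,
      LinearMap.lTensor_zero, LinearMap.zero_apply] at this
  have hw₂ : (-ψ).lTensor M w = z := by
    have := congrArg ((LinearMap.snd R P₀ N').lTensor M) hw
    rwa [← LinearMap.comp_apply, ← LinearMap.comp_apply, ← LinearMap.lTensor_comp,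
      ← LinearMap.lTensor_comp, LinearMap.snd_prod, LinearMap.snd_comp_inr,
      LinearMap.lTensor_id, LinearMap.id_apply] at this
  obtain ⟨I, hfg, hI, hIw⟩ := htor.1 (h _) w hw₁
  refine ⟨I, hfg, hI, fun a ha => ?_⟩
  obtain ⟨y, hy⟩ := hIw a ha
  rw [← hw₂, ← map_smul, ← hy, ← LinearMap.comp_apply, ← LinearMap.lTensor_comp,
    LinearMap.neg_comp, hψd, neg_zero, LinearMap.lTensor_zero, LinearMap.zero_apply]

theorem IsTauQFlat.flat_baseChange {R : Type u} [CommRing R] {M : Type u} [AddCommGroup M]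
    [Module R M] (h : IsTauQFlat R M) (S : Type u) [CommRing S] [Algebra R S]
    (hS : ∀ J : Ideal R, J.FG → J.IsSemiregular → J.map (algebraMap R S) = ⊤) :
    Module.Flat S (S ⊗[R] M) := by
  refine Module.Flat.iff_rTensor_injective'.2 fun I => ?_
  let e := TensorProduct.AlgebraTensorModule.cancelBaseChange R S S I M
  let e' := TensorProduct.AlgebraTensorModule.cancelBaseChange R S S S M
  have hcomm : (I.subtype.restrictScalars R).rTensor M ∘ₗ (e.restrictScalars R).toLinearMap =
      (e'.restrictScalars R).toLinearMap ∘ₗ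
        (I.subtype.rTensor (S ⊗[R] M)).restrictScalars R := by
    refine LinearMap.ext fun x => ?_
    induction x with
    | zero => simp only [map_zero]
    | add x y hx hy => simp only [map_add, hx, hy]
    | tmul x y =>
      induction y with
      | zero => simp only [TensorProduct.tmul_zero, map_zero]
      | add y z hy hz => simp only [TensorProduct.tmul_add, map_add, hy, hz]
      | tmul s m => simp [e, e']
  refine (injective_iff_map_eq_zero _).2 fun t ht => e.injective ?_
  rw [map_zero]
  have h0 : (I.subtype.restrictScalars R).lTensor M (TensorProduct.comm R I M (e t)) = 0 := by
    have := LinearMap.congr_fun hcomm t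
    simp only [LinearMap.comp_apply, LinearMap.restrictScalars_apply, ht, map_zero] at this
    rw [← LinearMap.comm_comp_rTensor_comp_comm_eq]
    simpa using this
  obtain ⟨J, hfg, hJ, hJt⟩ := h.exists_smul_eq_zero (i := I.subtype.restrictScalars R)
    Subtype.val_injective h0
  have hle : J.map (algebraMap R S) ≤ Ideal.torsionOf S (I ⊗[R] M) (e t) :=
    Ideal.map_le_iff_le_comap.2 fun a ha => by
      have := (TensorProduct.comm R I M).map_eq_zero_iff.1 ((map_smul _ a _).trans (hJt a ha))
      simpa [Ideal.mem_torsionOf_iff] using this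
  rw [hS J hfg hJ] at hle
  simpa using hle (Submodule.mem_top (x := (1 : S)))

theorem one_tmul_mkQ_eq_zero_of_flat {R : Type*} [CommRing R] {M : Type*} [AddCommGroup M]
    [Module R M] (S : Type*) [CommRing S] [Algebra R S] [Module.Flat R S]
    [Module.Flat S (S ⊗[R] M)] {P₂ P₁ P₀ : Type*} [AddCommGroup P₂] [Module R P₂]
    [AddCommGroup P₁] [Module R P₁] [AddCommGroup P₀] [Module R P₀] {d₂ : P₂ →ₗ[R] P₁}
    {d₁ : P₁ →ₗ[R] P₀} (hd : Function.Exact d₂ d₁) {w : M ⊗[R] P₁} (hw : d₁.lTensor M w = 0) :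
    (1 : S) ⊗ₜ[R] (LinearMap.range (d₂.lTensor M)).mkQ w = 0 := by
  have : Module.Flat R (S ⊗[R] M) := Module.Flat.trans R S _
  obtain ⟨y, hy⟩ := (Module.Flat.lTensor_exact (S ⊗[R] M) hd
    ((TensorProduct.assoc R S M P₁).symm (1 ⊗ₜ w))).1 (by
      simp [LinearMap.lTensor_tensor, hw])
  have hy' : (d₂.lTensor M).lTensor S (TensorProduct.assoc R S M P₂ y) = 1 ⊗ₜ w := by
    simpa [LinearMap.lTensor_tensor] using congrArg (TensorProduct.assoc R S M P₁) hy
  have := congrArg ((LinearMap.range (d₂.lTensor M)).mkQ.lTensor S) hy'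
  rw [← LinearMap.comp_apply, ← LinearMap.lTensor_comp, LinearMap.range_mkQ_comp,
    LinearMap.lTensor_zero, LinearMap.zero_apply, LinearMap.lTensor_tmul] at this
  exact this.symm

theorem isTauQFlat_of_forall {R : Type u} [CommRing R] {M : Type u} [AddCommGroup M] [Module R M]
    (h : ∀ (P₂ P₁ P₀ : ModuleCat.{u} R) (d₂ : P₂ →ₗ[R] P₁) (d₁ : P₁ →ₗ[R] P₀),
      Function.Exact d₂ d₁ → ∀ w : M ⊗[R] P₁, d₁.lTensor M w = 0 →
        ∃ I : Ideal R, I.FG ∧ I.IsSemiregular ∧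
          ∀ a ∈ I, a • (LinearMap.range (d₂.lTensor M)).mkQ w = 0) :
    IsTauQFlat R M := by
  intro N _ _
  obtain ⟨P₂, P₁, P₀, d₂, d₁, ε, _, h₂₁, h₁₀, hε, htor⟩ :=
    exists_resolution_isQTorsion_tor1Mod_iff R M N
  refine htor.2 fun w hw => ?_
  obtain ⟨I, hfg, hI, hIw⟩ := h _ _ _ d₂ d₁ h₂₁ w hw
  refine ⟨I, hfg, hI, fun a ha => ?_⟩
  rw [← Submodule.Quotient.mk_eq_zero]
  exact hIw a ha

/-- For an `R`-module `M` the following are equivalent: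
(1) `M` is τ_q-flat (`Tor_1^R(M, N)` is Q-torsion for all `N`);
(2) `M_m` is a flat `R_m`-module for every maximal q-ideal `m` of `R` (such ideals
are prime);
(3) `M ⊗_R T(R[x])` is a flat `T(R[x])`-module. -/
theorem statement10 (R : Type u) [CommRing R] (M : Type u) [AddCommGroup M] [Module R M] :
    List.TFAE
      [IsTauQFlat R M,
      ∀ (m : Ideal R) [m.IsPrime], ¬ m.IsSemiregular →
        (∀ I : Ideal R, ¬ I.IsSemiregular → m ≤ I → I = m) →
        Module.Flat (Localization.AtPrime m) (LocalizedModule m.primeCompl M),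
      Module.Flat (FractionRing (Polynomial R)) ((FractionRing (Polynomial R)) ⊗[R] M)] := by
  tfae_have 1 → 2 := fun h m _ hm _ =>
    have := h.flat_baseChange (Localization.AtPrime m) fun J _ hJ => hJ.map_atPrime_eq_top hm
    Module.Flat.of_linearEquiv (LocalizedModule.equivTensorProduct m.primeCompl M)
  tfae_have 1 → 3 := fun h =>
    h.flat_baseChange _ fun J hfg hJ => Ideal.map_fractionRing_polynomial_eq_top hfg hJ
  tfae_have 2 → 1 := fun h => isTauQFlat_of_forall fun P₂ P₁ P₀ d₂ d₁ hd w hw =>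
    Ideal.exists_smul_eq_zero_of_forall_atPrime fun m _ hm hmax => by
      have := h m hm hmax
      have : Module.Flat (Localization.AtPrime m) (Localization.AtPrime m ⊗[R] M) :=
        Module.Flat.of_linearEquiv (LocalizedModule.equivTensorProduct m.primeCompl M).symm
      exact one_tmul_mkQ_eq_zero_of_flat _ hd hw
  tfae_have 3 → 1 := fun h => isTauQFlat_of_forall fun P₂ P₁ P₀ d₂ d₁ hd w hw => by
    have : Module.Flat R (FractionRing R[X]) := Module.Flat.trans R R[X] _
    exact Polynomial.exists_smul_eq_zero_of_one_tmul_eq_zero (one_tmul_mkQ_eq_zero_of_flat _ hd hw)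
  tfae_finish
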